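/- Let p = p_1 + p_2 with p_1, p_2 ≥ 1 and fix m ≥ 2. Consider control units i = 1, …, N with true covariates z_i ∈ ℝ^p and treated units l = 1, …, N_1 with true covariates y_l ∈ ℝ^p, each unit having exactly m replicated measurements (z*_{i,j} for controls, y*_{l,j} for treated, j = 1, …, m) whose last p_2 coordinates are error-free: z*_{i,j,k} = z_{i,k} and y*_{l,j,k} = y_{l,k} for every k > p_1. Define η̂_0(θ) = [ ( (N+N_1) m(m−1) )^{-1} Σ_{all units i} Σ_{1 ≤ j ≠ k ≤ m} exp⟨θ, v*_{i,j} − v*_{i,k}⟩ ]^{1/2} (where v* denotes the unit's replicates), which is positive and differentiable, and let η̂_1(θ) be its gradient. Define B_HL(θ) = [Σ_{i=1}^N m^{-1} η̂_0(θ)^{-1} Σ_{j=1}^m exp⟨θ, z*_{i,j}⟩ (z*_{i,j} − η̂_0(θ)^{-1} η̂_1(θ))] / [Σ_{i=1}^N m^{-1} η̂_0(θ)^{-1} Σ_{j=1}^m exp⟨θ, z*_{i,j}⟩] − (N_1 m)^{-1} Σ_{l=1}^{N_1} Σ_{j=1}^m y*_{l,j}. If θ̂ satisfies B_HL(θ̂)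 = 0, then the weights ŵ_{c,i} = [Σ_{j=1}^m exp⟨θ̂, z*_{i,j}⟩] / [Σ_{i'=1}^N Σ_{j=1}^m exp⟨θ̂, z*_{i',j}⟩] satisfy, for every coordinate k > p_1: Σ_{i=1}^N ŵ_{c,i} z_{i,k} = N_1^{-1} Σ_{l=1}^{N_1} y_{l,k}. -/

import Mathlib

open scoped RealInnerProductSpace BigOperators

/-- CEB-HL part of Theorem 7: With exactly `m ≥ 2` replicated measurements per
unit whose last `p₂` coordinates are error-free, `η̂₀(θ)` the square root of the averaged
exponential of within-unit replicate differences (over all control and treated units) and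
`η̂₁ = ∇η̂₀`, if `θ̂` solves the Hu–Lin corrected estimating equation `B_HL(θ̂) = 0`, then the
CEB-HL weights exactly balance the true covariates in every coordinate `k > p₁`. -/
theorem ceb_hl_balances_error_free_coordinates
    (p1 p2 N N1 m : ℕ) (hp1 : 1 ≤ p1) (hp2 : 1 ≤ p2) (hN : 1 ≤ N) (hN1 : 1 ≤ N1)
    (hm : 2 ≤ m)
    (z : Fin N → EuclideanSpace ℝ (Fin (p1 + p2)))
    (zstar : Fin N → Fin m → EuclideanSpace ℝ (Fin (p1 + p2)))
    (hz : ∀ i j (k : Fin (p1 + p2)), p1 ≤ (k : ℕ) → zstar i j k = z i k)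
    (y : Fin N1 → EuclideanSpace ℝ (Fin (p1 + p2)))
    (ystar : Fin N1 → Fin m → EuclideanSpace ℝ (Fin (p1 + p2)))
    (hy : ∀ l j (k : Fin (p1 + p2)), p1 ≤ (k : ℕ) → ystar l j k = y l k)
    (η0 : EuclideanSpace ℝ (Fin (p1 + p2)) → ℝ)
    (hη0 : ∀ θ, η0 θ = Real.sqrt
      ((((N : ℝ) + (N1 : ℝ)) * (m : ℝ) * ((m : ℝ) - 1))⁻¹ *
        ((∑ i, ∑ j, ∑ k, if j ≠ k then Real.exp ⟪θ, zstar i j - zstar i k⟫ else 0)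
          + ∑ l, ∑ j, ∑ k, if j ≠ k then Real.exp ⟪θ, ystar l j - ystar l k⟫ else 0)))
    (η1 : EuclideanSpace ℝ (Fin (p1 + p2)) → EuclideanSpace ℝ (Fin (p1 + p2)))
    (hη1 : ∀ θ, η1 θ = gradient η0 θ)
    (θhat : EuclideanSpace ℝ (Fin (p1 + p2)))
    (hroot :
      (∑ i, (m : ℝ)⁻¹ * (η0 θhat)⁻¹ * ∑ j, Real.exp ⟪θhat, zstar i j⟫)⁻¹ •
          (∑ i, ((m : ℝ)⁻¹ * (η0 θhat)⁻¹) •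
            ∑ j, Real.exp ⟪θhat, zstar i j⟫ • (zstar i j - (η0 θhat)⁻¹ • η1 θhat))
        - ((N1 : ℝ) * (m : ℝ))⁻¹ • ∑ l, ∑ j, ystar l j = 0)
    (w : Fin N → ℝ)
    (hw : ∀ i, w i = (∑ j, Real.exp ⟪θhat, zstar i j⟫)
        / ∑ i', ∑ j, Real.exp ⟪θhat, zstar i' j⟫) :
    ∀ k : Fin (p1 + p2), p1 ≤ (k : ℕ) →
      ∑ i, w i * z i k = (N1 : ℝ)⁻¹ * ∑ l, y l k := by
  intro k hk
  have hm0 : (m : ℝ) ≠ 0 := by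
    have : m ≠ 0 := by omega
    exact_mod_cast this
  have hN10 : (N1 : ℝ) ≠ 0 := by
    have : N1 ≠ 0 := by omega
    exact_mod_cast this
  -- invariance of η0 in direction k
  have hzi : ∀ (t : ℝ) θ i j j', ⟪θ + t • EuclideanSpace.single k (1 : ℝ), zstar i j - zstar i j'⟫
      = ⟪θ, zstar i j - zstar i j'⟫ := by
    intro t θ i j j'
    rw [inner_add_left, inner_smul_left, EuclideanSpace.inner_single_left]
    simp [hz i j k hk, hz i j' k hk]
  have hyi : ∀ (t : ℝ) θ i j j', ⟪θ + t • EuclideanSpace.single k (1 : ℝ), ystar i j - ystar i j'⟫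
      = ⟪θ, ystar i j - ystar i j'⟫ := by
    intro t θ i j j'
    rw [inner_add_left, inner_smul_left, EuclideanSpace.inner_single_left]
    simp [hy i j k hk, hy i j' k hk]
  have hinv : ∀ (t : ℝ) θ, η0 (θ + t • EuclideanSpace.single k (1 : ℝ)) = η0 θ := by
    intro t θ
    rw [hη0, hη0]
    simp only [hzi, hyi]
  have hgrad : η1 θhat k = 0 := by
    rw [hη1]
    by_cases hd : DifferentiableAt ℝ η0 θhat
    · have h1 : lineDeriv ℝ η0 θhat (EuclideanSpace.single k (1 : ℝ)) = 0 := by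
        unfold lineDeriv
        simp only [hinv]
        simp
      rw [hd.lineDeriv_eq_fderiv] at h1
      have h2 : ⟪gradient η0 θhat, EuclideanSpace.single k (1 : ℝ)⟫ = 0 := by
        rw [gradient, InnerProductSpace.toDual_symm_apply, h1]
      rw [EuclideanSpace.inner_single_right] at h2
      simpa using h2
    · rw [gradient_eq_zero_of_not_differentiableAt hd]
      simp
  have hpos : 0 < η0 θhat := by
    rw [hη0]
    apply Real.sqrt_pos.mpr
    have hm1 : (1 : ℝ) < m := by exact_mod_cast (by omega : 1 < m)
    have hNp : (0 : ℝ) < N := by exact_mod_cast (by omega : 0 < N)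
    have hN1p : (0 : ℝ) < N1 := by exact_mod_cast (by omega : 0 < N1)
    have hnn : ∀ (c : Prop) [Decidable c] (x : ℝ), 0 ≤ if c then Real.exp x else 0 := by
      intro c _ x
      split_ifs
      · exact (Real.exp_pos _).le
      · exact le_rfl
    apply mul_pos
    · apply inv_pos.mpr
      have : (0 : ℝ) < m - 1 := by linarith
      positivity
    · apply add_pos_of_pos_of_nonneg
      · apply Finset.sum_pos' (fun i _ => Finset.sum_nonneg fun j _ => Finset.sum_nonneg
          fun j' _ => hnn _ _)
        refine ⟨⟨0, by omega⟩, Finset.mem_univ _, ?_⟩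
        apply Finset.sum_pos' (fun j _ => Finset.sum_nonneg fun j' _ => hnn _ _)
        refine ⟨⟨0, by omega⟩, Finset.mem_univ _, ?_⟩
        apply Finset.sum_pos' (fun j' _ => hnn _ _)
        refine ⟨⟨1, by omega⟩, Finset.mem_univ _, ?_⟩
        rw [if_pos (by simp)]
        exact Real.exp_pos _
      · exact Finset.sum_nonneg fun i _ => Finset.sum_nonneg fun j _ => Finset.sum_nonneg
          fun j' _ => hnn _ _
  have hc : (m : ℝ)⁻¹ * (η0 θhat)⁻¹ ≠ 0 := mul_ne_zero (inv_ne_zero hm0) (inv_ne_zero hpos.ne')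
  have h := congrArg (fun v : EuclideanSpace ℝ (Fin (p1 + p2)) => v k) hroot
  simp only [PiLp.sub_apply, PiLp.smul_apply, WithLp.ofLp_sum, Finset.sum_apply, smul_eq_mul,
    hgrad, mul_zero, sub_zero, hz _ _ k hk, hy _ _ k hk, PiLp.zero_apply] at h
  simp only [← Finset.sum_mul, Finset.sum_const, Finset.card_univ, Fintype.card_fin,
    nsmul_eq_mul, ← Finset.mul_sum] at h
  simp only [hw, div_mul_eq_mul_div, ← Finset.sum_div]
  generalize (m : ℝ)⁻¹ * (η0 θhat)⁻¹ = c at h hc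
  have h' := sub_eq_zero.mp h
  rw [mul_inv, mul_mul_mul_comm, inv_mul_cancel₀ hc, one_mul] at h'
  rw [div_eq_inv_mul, h', mul_inv, mul_assoc, inv_mul_cancel_left₀ hm0]
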